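/- If the side information graph G on N vertices contains no directed cycles of length t or less, and there exists a scalar linear index code of length ℓ for G, then broadcast rate ℓ is achievable with locality (t + (N − t)ℓ)/N. -/

import Mathlib

open Finset

/-- A unicast index coding problem on `N` receivers: receiver `i` demands message `i`
and knows messages indexed by `K i` as side information, with `i ∉ K i`. -/
structure IndexProblem (N : ℕ) where
  K : Fin N → Finset (Fin N)
  not_self : ∀ i, i ∉ K i

/-- A valid index code over alphabet `A` with message length `m` and codeword length `ℓ`:
an encoder together with query sets `R i`, such that receiver `i` can decode `x i`
exactly from the queried codeword symbols `c_{R i}` and its side information. -/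
structure IndexCode (N : ℕ) (G : IndexProblem N) (A : Type*) (m ℓ : ℕ) where
  enc : (Fin N → Fin m → A) → Fin ℓ → A
  R : Fin N → Finset (Fin ℓ)
  valid : ∀ (i : Fin N) (x y : Fin N → Fin m → A),
    (∀ t ∈ R i, enc x t = enc y t) → (∀ j ∈ G.K i, x j = y j) → x i = y i

/-- The optimal broadcast rate function `β_G^*(r)`: the infimum of broadcast rates `ℓ/m`
over all message lengths `m ≥ 1` and valid index codes with locality at most `r`. -/
noncomputable def betaStar (A : Type*) {N : ℕ} (G : IndexProblem N) (r : ℝ) : ℝ :=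
  sInf {β : ℝ | ∃ (m ℓ : ℕ) (_ : 0 < m) (C : IndexCode N G A m ℓ),
    (∀ i, ((C.R i).card : ℝ) ≤ r * m) ∧ β = (ℓ : ℝ) / m}

/-- A matrix `A` fits the side information graph `G` if its diagonal entries are `1`
and `A j i = 0` for all `i ≠ j` with `j ∉ K i`. -/
def Fits {N : ℕ} {F : Type*} [Field F] (G : IndexProblem N)
    (A : Matrix (Fin N) (Fin N) F) : Prop :=
  (∀ i, A i i = 1) ∧ ∀ i j, j ≠ i → j ∉ G.K i → A j i = 0

/-- `B` is a valid scalar linear encoding matrix for `G`: every receiver `i` can recover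
`x i` from the codeword `c = x B` and its side information `(x j, j ∈ K i)`. -/
def IsValidEncMatrix {N ℓ : ℕ} {F : Type*} [Field F] (G : IndexProblem N)
    (B : Matrix (Fin N) (Fin ℓ) F) : Prop :=
  ∀ (i : Fin N) (x y : Fin N → F),
    Matrix.vecMul x B = Matrix.vecMul y B → (∀ j ∈ G.K i, x j = y j) → x i = y i

/-- The column space of a matrix, i.e. the span of its columns. -/
def colSpace {n ℓ : ℕ} {F : Type*} [Field F] (B : Matrix (Fin n) (Fin ℓ) F) :
    Submodule F (Fin n → F) :=
  Submodule.span F (Set.range B.transpose)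

/-- There is a (nonempty) closed directed walk inside the vertex set `S`, where the edges of
the side information graph are `(i, j)` with `j ∈ K i`.  Its absence is equivalent to the
induced subgraph `G_S` being a directed acyclic graph. -/
def HasDirCycleIn {N : ℕ} (K : Fin N → Finset (Fin N)) (S : Finset (Fin N)) : Prop :=
  ∃ (n : ℕ) (v : ℕ → Fin N), 0 < n ∧ (∀ k ≤ n, v k ∈ S) ∧
    (∀ k < n, v (k + 1) ∈ K (v k)) ∧ v n = v 0

/-- In a scalar linear code, the symbol wanted by receiver `i` is a linear combination of the
codeword symbols and of the side information. -/
theorem IsValidEncMatrix.exists_decoding {N ℓ : ℕ} {F : Type*} [Field F] {G : IndexProblem N}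
    {B : Matrix (Fin N) (Fin ℓ) F} (hB : IsValidEncMatrix G B) (i : Fin N) :
    ∃ (d : Fin ℓ → F) (f : Fin N → F), (∀ j, j ∉ G.K i → f j = 0) ∧
      ∀ x : Fin N → F, x i = d ⬝ᵥ Matrix.vecMul x B + f ⬝ᵥ x := by
  classical
  let L : Fin ℓ ⊕ G.K i → (Fin N → F) →ₗ[F] F :=
    Sum.elim (fun k => LinearMap.proj k ∘ₗ B.vecMulLinear) (fun j => LinearMap.proj j.1)
  have hL : (LinearMap.proj i : (Fin N → F) →ₗ[F] F) ∈ Submodule.span F (Set.range L) := by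
    apply mem_span_of_iInf_ker_le_ker
    intro x hx
    simp only [Submodule.mem_iInf, LinearMap.mem_ker] at hx ⊢
    refine hB i x 0 ?_ fun j hj => hx (Sum.inr ⟨j, hj⟩)
    ext k
    simpa [L] using hx (Sum.inl k)
  obtain ⟨c, hc⟩ := (Submodule.mem_span_range_iff_exists_fun F).1 hL
  refine ⟨fun k => c (Sum.inl k), fun j => if h : j ∈ G.K i then c (Sum.inr ⟨j, h⟩) else 0,
    fun j hj => dif_neg hj, fun x => ?_⟩
  have hx := LinearMap.congr_fun hc x
  simp only [L, Fintype.sum_sum_type, LinearMap.add_apply, LinearMap.sum_apply,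
    LinearMap.smul_apply, smul_eq_mul, Sum.elim_inl, Sum.elim_inr, LinearMap.comp_apply,
    LinearMap.proj_apply, Matrix.vecMulLinear_apply] at hx
  rw [← hx]
  congr 1
  simp only [dotProduct, dite_mul, zero_mul]
  rw [Finset.sum_dite]
  simp only [Finset.sum_const_zero, add_zero]
  refine Finset.sum_bij' (fun j _ => ⟨j.1, by simp⟩) (fun j _ => ⟨j.1, by simpa using j.2⟩)
    ?_ ?_ ?_ ?_ ?_ <;> simp

/-- If every vertex of a nonempty set `T` has a predecessor in `T`, then there is a closed walk
of length at most `#T`. -/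
theorem exists_closed_walk_of_forall_exists_pred {V : Type*} (K : V → Finset V)
    {T : Finset V} (hT : T.Nonempty) (h : ∀ v ∈ T, ∃ u ∈ T, v ∈ K u) :
    ∃ (n : ℕ) (v : ℕ → V), 0 < n ∧ n ≤ #T ∧ (∀ k < n, v (k + 1) ∈ K (v k)) ∧ v n = v 0 := by
  choose! p hpT hpK using h
  obtain ⟨v₀, hv₀⟩ := hT
  have hw : ∀ k, p^[k] v₀ ∈ T := fun k => by
    induction k with
    | zero => exact hv₀
    | succ k ih => rw [Function.iterate_succ_apply']; exact hpT _ ih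
  obtain ⟨a, ha, b, hb, hne, hab⟩ := Finset.exists_ne_map_eq_of_card_lt_of_maps_to
    (s := range (#T + 1)) (t := T) (by simp) (f := fun k => p^[k] v₀) (fun k _ => hw k)
  wlog hlt : a < b generalizing a b
  · exact this b hb a ha hne.symm hab.symm (by omega)
  simp only [mem_range] at hb
  refine ⟨b - a, fun k => p^[b - k] v₀, by omega, by omega, fun k hk => ?_, ?_⟩
  · have : b - k = (b - (k + 1)) + 1 := by omega
    simp only [this, Function.iterate_succ_apply']
    exact hpK _ (hw _)
  · simpa [Nat.sub_sub_self hlt.le] using hab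

/-- The decoding vectors of the receivers in a set without short closed walks are linearly
independent. -/
theorem linearIndependent_of_no_short_cycles {N t ℓ : ℕ} {F : Type*} [Field F]
    (G : IndexProblem N)
    (hnc : ¬ ∃ (n : ℕ) (v : ℕ → Fin N), 0 < n ∧ n ≤ t ∧
      (∀ k < n, v (k + 1) ∈ G.K (v k)) ∧ v n = v 0)
    (B : Matrix (Fin N) (Fin ℓ) F) (d : Fin N → Fin ℓ → F) (f : Fin N → Fin N → F)
    (hf : ∀ i j, j ∉ G.K i → f i j = 0)
    (hd : ∀ i (x : Fin N → F), x i = d i ⬝ᵥ Matrix.vecMul x B + f i ⬝ᵥ x)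
    {S : Finset (Fin N)} (hS : #S ≤ t) :
    LinearIndependent F (fun i : S => d i) := by
  classical
  refine (linearIndepOn_finset_iff (s := S) (v := d)).2 fun g hg => ?_
  by_contra! hne
  obtain ⟨i₀, hi₀, hgi₀⟩ := hne
  let T := S.filter fun i => g i ≠ 0
  have key : ∀ v ∈ T, ∃ u ∈ T, v ∈ G.K u := by
    intro v hv
    obtain ⟨hvS, hgv⟩ := Finset.mem_filter.1 hv
    by_contra! hno
    refine hgv ?_
    have hcomb : ∀ x : Fin N → F,
        ∑ i ∈ S, g i * x i = ∑ i ∈ S, g i * (f i ⬝ᵥ x) := by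
      intro x
      have h0 : ∑ i ∈ S, g i * (d i ⬝ᵥ Matrix.vecMul x B) = 0 := by
        have := congrArg (fun u => u ⬝ᵥ Matrix.vecMul x B) hg
        simpa [sum_dotProduct, smul_dotProduct] using this
      calc ∑ i ∈ S, g i * x i
          = ∑ i ∈ S, (g i * (d i ⬝ᵥ Matrix.vecMul x B) + g i * (f i ⬝ᵥ x)) :=
            Finset.sum_congr rfl fun i _ => by rw [← mul_add, ← hd i x]
        _ = _ := by rw [Finset.sum_add_distrib, h0, zero_add]
    have hv' := hcomb (Pi.single v 1)
    simp only [dotProduct_single_one] at hv'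
    rw [Finset.sum_eq_single_of_mem v hvS (fun i _ hi => by simp [hi.symm])] at hv'
    rw [Pi.single_eq_same, mul_one] at hv'
    rw [hv']
    refine Finset.sum_eq_zero fun i hi => ?_
    by_cases hgi : g i = 0
    · simp [hgi]
    · simp [hf i v (hno i (Finset.mem_filter.2 ⟨hi, hgi⟩))]
  obtain ⟨n, v, hn, hnT, hv⟩ := exists_closed_walk_of_forall_exists_pred G.K
    ⟨i₀, Finset.mem_filter.2 ⟨hi₀, hgi₀⟩⟩ key
  exact hnc ⟨n, v, hn, hnT.trans ((Finset.card_filter_le _ _).trans hS), hv⟩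

/-- A scalar code of length `ℓ` can be transformed so that every receiver in a given set of at
most `t` vertices queries a single symbol. -/
theorem exists_scalar_code_query_one {N t ℓ : ℕ} {F : Type*} [Field F]
    (G : IndexProblem N)
    (hnc : ¬ ∃ (n : ℕ) (v : ℕ → Fin N), 0 < n ∧ n ≤ t ∧
      (∀ k < n, v (k + 1) ∈ G.K (v k)) ∧ v n = v 0)
    {B : Matrix (Fin N) (Fin ℓ) F} (hB : IsValidEncMatrix G B)
    (S : Finset (Fin N)) (hS : #S ≤ t) :
    ∃ (enc : (Fin N → F) → Fin ℓ → F) (R : Fin N → Finset (Fin ℓ)),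
      (∀ i ∈ S, #(R i) = 1) ∧
      ∀ (i : Fin N) (x y : Fin N → F),
        (∀ k ∈ R i, enc x k = enc y k) → (∀ j ∈ G.K i, x j = y j) → x i = y i := by
  classical
  choose d f hf hd using hB.exists_decoding
  have hli := linearIndependent_of_no_short_cycles G hnc B d f hf hd hS
  let b := Module.Basis.sumExtend hli
  have : Finite (S ⊕ Module.Basis.sumExtendIndex hli) := Module.Finite.finite_basis b
  have : Fintype (S ⊕ Module.Basis.sumExtendIndex hli) := Fintype.ofFinite _
  let e : S ⊕ Module.Basis.sumExtendIndex hli ≃ Fin ℓ := Fintype.equivFinOfCardEq (by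
    rw [← Module.finrank_eq_card_basis b, Module.finrank_fin_fun])
  let b' := b.reindex e
  have hb' : ∀ i : S, b' (e (Sum.inl i)) = d i := fun i => by
    simp only [b', b, Module.Basis.sumExtend, Module.Basis.reindex_apply,
      Equiv.symm_apply_apply, Module.Basis.extend_apply_self]
    rfl
  refine ⟨fun x k => b' k ⬝ᵥ Matrix.vecMul x B,
    fun i => if h : i ∈ S then {e (Sum.inl ⟨i, h⟩)} else univ,
    fun i hi => by simp [hi], fun i x y hxy hK => ?_⟩
  by_cases hi : i ∈ S
  · simp only [hi, dite_true, mem_singleton, forall_eq, hb'] at hxy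
    rw [hd i x, hd i y, hxy]
    congr 1
    refine Finset.sum_congr rfl fun j _ => ?_
    by_cases hj : j ∈ G.K i
    · rw [hK j hj]
    · simp [hf i j hj]
  · simp only [hi, dite_false, mem_univ, true_imp_iff] at hxy
    refine hB i x y ?_ hK
    have hlin : (dotProductBilin F F).flip (Matrix.vecMul x B) =
        (dotProductBilin F F).flip (Matrix.vecMul y B) := b'.ext hxy
    exact dotProduct_eq _ _ fun u => by
      simpa [dotProduct_comm] using LinearMap.congr_fun hlin u

/-- Each vertex lies in exactly `t` of the `N` cyclic intervals of length `t`, and each such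
interval has `t` elements. -/
theorem exists_uniform_cover {N t : ℕ} (htN : t ≤ N) :
    ∃ S : Fin N → Finset (Fin N), (∀ a, #(S a) = t) ∧ ∀ i, #{a | i ∈ S a} = t := by
  rcases Nat.eq_zero_or_pos N with rfl | hN
  · exact ⟨fun _ => ∅, fun a => a.elim0, fun i => i.elim0⟩
  have : NeZero N := ⟨hN.ne'⟩
  have hcard : #{k : Fin N | k.val < t} = t := by
    rw [Fin.card_filter_val_lt, min_eq_right htN]
  refine ⟨fun a => {i | (i - a).val < t}, fun a => ?_, fun i => ?_⟩
  · exact (Finset.card_equiv (Equiv.subRight a) (by simp)).trans hcard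
  · exact (Finset.card_equiv (Equiv.subLeft i) (by simp)).trans hcard

/-- if `G` (on `N` vertices) contains no directed cycles of length `t` or less,
and `G` has a scalar linear index code of length `ℓ`, then broadcast rate `ℓ` is achievable
with locality `(t + (N − t)ℓ)/N`. -/
theorem no_short_cycles_locality {N t ℓ : ℕ} {F : Type*} [Field F]
    (G : IndexProblem N) (ht : 0 < t) (htN : t ≤ N)
    (hnc : ¬ ∃ (n : ℕ) (v : ℕ → Fin N), 0 < n ∧ n ≤ t ∧
      (∀ k < n, v (k + 1) ∈ G.K (v k)) ∧ v n = v 0)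
    (hB : ∃ B : Matrix (Fin N) (Fin ℓ) F, IsValidEncMatrix G B) :
    (∃ C : IndexCode N G F N (N * ℓ), ∀ i,
        ((C.R i).card : ℝ) ≤ (t : ℝ) + ((N : ℝ) - t) * ℓ) ∧
    betaStar F G (((t : ℝ) + ((N : ℝ) - t) * ℓ) / N) ≤ ℓ := by
  classical
  obtain ⟨B, hB⟩ := hB
  obtain ⟨S, hS, hcov⟩ := exists_uniform_cover htN
  choose enc R hR hvalid using fun a =>
    exists_scalar_code_query_one G hnc hB (S a) (hS a).le
  let C : IndexCode N G F N (N * ℓ) :=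
    { enc := fun x p =>
        enc (finProdFinEquiv.symm p).1 (fun i => x i (finProdFinEquiv.symm p).1)
          (finProdFinEquiv.symm p).2
      R := fun i => (univ.sigma fun a => R a i).map
        ((Equiv.sigmaEquivProd _ _).trans finProdFinEquiv).toEmbedding
      valid := fun i x y hxy hK => by
        funext a
        refine hvalid a i (fun i => x i a) (fun i => y i a) (fun k hk => ?_)
          fun j hj => congrFun (hK j hj) a
        have := hxy (finProdFinEquiv (a, k)) (Finset.mem_map.2 ⟨⟨a, k⟩, by simpa using hk, rfl⟩)
        simpa only [Equiv.symm_apply_apply] using this }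
  have hC : ∀ i, ((C.R i).card : ℝ) ≤ (t : ℝ) + ((N : ℝ) - t) * ℓ := fun i => by
    have hnot : #{a | i ∉ S a} = N - t := by
      have := Finset.card_filter_add_card_filter_not (s := univ) (fun a => i ∈ S a)
      rw [hcov i, card_univ, Fintype.card_fin] at this
      omega
    have hle : (C.R i).card ≤ t + (N - t) * ℓ := calc
      (C.R i).card = ∑ a, #(R a i) := by rw [Finset.card_map, Finset.card_sigma]
      _ ≤ ∑ a, if i ∈ S a then 1 else ℓ := Finset.sum_le_sum fun a _ => by
        split_ifs with h
        · exact (hR a i h).le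
        · exact card_finset_fin_le _
      _ = t + (N - t) * ℓ := by
        rw [Finset.sum_ite, Finset.sum_const, Finset.sum_const, hcov i, hnot]
        simp
    rw [← Nat.cast_sub htN]
    exact_mod_cast hle
  have hN : 0 < N := ht.trans_le htN
  have hN' : (N : ℝ) ≠ 0 := by positivity
  refine ⟨⟨C, hC⟩, csInf_le ⟨0, ?_⟩ ⟨N, N * ℓ, hN, C, fun i => ?_, ?_⟩⟩
  · rintro _ ⟨m, l, -, -, -, rfl⟩
    positivity
  · rw [div_mul_cancel₀ _ hN']
    exact hC i
  · push_cast
    field_simp
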